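/- Let H be a real Hilbert space, let A_i : H → Set H (i = 1,…,r) be maximally monotone operators, let γ > 0, β ∈ (0,1), let (λ_n) be a sequence in [0,1] with ∑ λ_n(1−λ_n) = ∞, and suppose q ∈ ran(Id + (γ/(r(1−β))) ∑_{i=1}^r A_i). Given x_{1,0},…,x_{r,0} ∈ H, define for n ≥ 0: p_n = (1/r) ∑_{i=1}^r x_{i,n} and x_{i,n+1} = (1−λ_n) x_{i,n} + λ_n (2β J_{γ(A_i)_{−q}} − Id)(2 p_n − x_{i,n}), where J_{γ(A_i)_{−q}}(x) is the unique y with x − y ∈ γ • A_i(y + q). Then each sequence (x_{i,n}) converges weakly to some x_i* ∈ H, q + (1/(βr)) ∑_{i=1}^r x_i* = J_{(γ/(r(1−β))) ∑ A_i}(q), and the sequence (q + (1/β) p_n) converges strongly (in norm) to J_{(γ/(r(1−β))) ∑ A_i}(q). -/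

import Mathlib

open Pointwise RealInnerProductSpace Filter Finset

/-- A set-valued operator `A : H → Set H` is monotone if
`⟪x − y, u − v⟫ ≥ 0` for all `(x,u), (y,v)` in its graph. -/
def MonotoneOp {H : Type*} [NormedAddCommGroup H] [InnerProductSpace ℝ H]
    (A : H → Set H) : Prop :=
  ∀ x y u v : H, u ∈ A x → v ∈ A y → 0 ≤ ⟪x - y, u - v⟫

/-- A set-valued operator is maximally monotone if it is monotone and `(x,u)` belongs
to its graph whenever `⟪x − y, u − v⟫ ≥ 0` for all `(y,v)` in its graph. -/
def MaxMonotoneOp {H : Type*} [NormedAddCommGroup H] [InnerProductSpace ℝ H]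
    (A : H → Set H) : Prop :=
  MonotoneOp A ∧ ∀ x u : H, (∀ y v : H, v ∈ A y → 0 ≤ ⟪x - y, u - v⟫) → u ∈ A x

/-- The range of `Id + A`: `ran(Id + A) = {x + u | x ∈ H, u ∈ A x}`. -/
def ranIdAdd {H : Type*} [AddCommGroup H] (A : H → Set H) : Set H :=
  {y | ∃ x : H, ∃ u ∈ A x, y = x + u}

/-- A bounded sequence in a Hilbert space has a weak limit along every ultrafilter. -/
theorem exists_weak_limit_ultrafilter {E : Type*} [NormedAddCommGroup E] [InnerProductSpace ℝ E]
    [CompleteSpace E] (U : Ultrafilter ℕ) (x : ℕ → E) (C : ℝ) (hC : ∀ n, ‖x n‖ ≤ C) :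
    ∃ w : E, ∀ z, Tendsto (fun n => ⟪x n, z⟫) U (nhds ⟪w, z⟫) := by
  have hbound : ∀ z n, |⟪x n, z⟫| ≤ C * ‖z‖ := fun z n =>
    (abs_real_inner_le_norm _ _).trans (mul_le_mul_of_nonneg_right (hC n) (norm_nonneg z))
  have hlim : ∀ z, ∃ a : ℝ, Tendsto (fun n => ⟪x n, z⟫) U (nhds a) := by
    intro z
    obtain ⟨a, -, ha⟩ := (isCompact_Icc (a := -(C * ‖z‖)) (b := C * ‖z‖)).ultrafilter_le_nhds
      (U.map fun n => ⟪x n, z⟫)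
      (le_principal_iff.mpr (Filter.mem_map.mpr
        (Filter.univ_mem' fun n => abs_le.mp (hbound z n))))
    exact ⟨a, ha⟩
  choose f hf using hlim
  let φ : E →ₗ[ℝ] ℝ :=
    { toFun := f
      map_add' := fun y z => tendsto_nhds_unique (hf (y + z))
        (by simpa only [inner_add_right] using (hf y).add (hf z))
      map_smul' := fun c z => tendsto_nhds_unique (hf (c • z))
        (by simpa only [inner_smul_right, RingHom.id_apply, smul_eq_mul] using (hf z).const_mul c) }
  let ψ : StrongDual ℝ E := φ.mkContinuous C fun z =>
    le_of_tendsto (hf z).abs (Eventually.of_forall (hbound z))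
  refine ⟨(InnerProductSpace.toDual ℝ E).symm ψ, fun z => ?_⟩
  rw [InnerProductSpace.toDual_symm_apply]
  exact hf z

theorem norm_one_sub_smul_add_smul_sq {E : Type*} [NormedAddCommGroup E] [InnerProductSpace ℝ E]
    (t : ℝ) (a b : E) :
    ‖(1 - t) • a + t • b‖ ^ 2 =
      (1 - t) * ‖a‖ ^ 2 + t * ‖b‖ ^ 2 - t * (1 - t) * ‖a - b‖ ^ 2 := by
  rw [norm_add_sq_real, norm_sub_sq_real, norm_smul, norm_smul, inner_smul_left, inner_smul_right]
  simp only [mul_pow, Real.norm_eq_abs, sq_abs, conj_trivial]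
  ring

section KrasnoselskiiMann

variable {E : Type*} [NormedAddCommGroup E] [InnerProductSpace ℝ E] {N : E → E}
  {lam : ℕ → ℝ} {x : ℕ → E}

theorem krasnoselskiiMann_norm_sub_sq_le (hN : ∀ a b, ‖N a - N b‖ ≤ ‖a - b‖)
    (hlam : ∀ n, lam n ∈ Set.Icc (0 : ℝ) 1)
    (hx : ∀ n, x (n + 1) = (1 - lam n) • x n + lam n • N (x n))
    {z : E} (hz : N z = z) (n : ℕ) :
    ‖x (n + 1) - z‖ ^ 2 + lam n * (1 - lam n) * ‖x n - N (x n)‖ ^ 2 ≤ ‖x n - z‖ ^ 2 := by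
  have h1 : x (n + 1) - z = (1 - lam n) • (x n - z) + lam n • (N (x n) - z) := by
    rw [hx]; module
  have h2 : ‖N (x n) - z‖ ^ 2 ≤ ‖x n - z‖ ^ 2 := by
    have := hN (x n) z
    rw [hz] at this
    gcongr
  rw [h1, norm_one_sub_smul_add_smul_sq, sub_sub_sub_cancel_right]
  linarith [mul_le_mul_of_nonneg_left h2 (hlam n).1]

theorem krasnoselskiiMann_antitone_norm_sub (hN : ∀ a b, ‖N a - N b‖ ≤ ‖a - b‖)
    (hlam : ∀ n, lam n ∈ Set.Icc (0 : ℝ) 1)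
    (hx : ∀ n, x (n + 1) = (1 - lam n) • x n + lam n • N (x n))
    {z : E} (hz : N z = z) : Antitone fun n => ‖x n - z‖ := by
  refine antitone_nat_of_succ_le fun n => ?_
  have h := krasnoselskiiMann_norm_sub_sq_le hN hlam hx hz n
  have h' := mul_nonneg (mul_nonneg (hlam n).1 (sub_nonneg.mpr (hlam n).2))
    (sq_nonneg ‖x n - N (x n)‖)
  exact le_of_sq_le_sq (by linarith) (norm_nonneg _)

/-- Asymptotic regularity of the Krasnoselskii–Mann iteration. -/
theorem krasnoselskiiMann_tendsto_norm_sub_apply (hN : ∀ a b, ‖N a - N b‖ ≤ ‖a - b‖)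
    (hlam : ∀ n, lam n ∈ Set.Icc (0 : ℝ) 1)
    (hlamsum : ¬ Summable (fun n => lam n * (1 - lam n)))
    (hx : ∀ n, x (n + 1) = (1 - lam n) • x n + lam n • N (x n))
    {z : E} (hz : N z = z) :
    Tendsto (fun n => ‖x n - N (x n)‖) atTop (nhds 0) := by
  have hanti : Antitone fun n => ‖x n - N (x n)‖ := by
    refine antitone_nat_of_succ_le fun n => ?_
    have h1 : x (n + 1) - N (x n) = (1 - lam n) • (x n - N (x n)) := by rw [hx]; module
    have h2 : x n - x (n + 1) = lam n • (x n - N (x n)) := by rw [hx]; module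
    calc ‖x (n + 1) - N (x (n + 1))‖
        ≤ ‖x (n + 1) - N (x n)‖ + ‖N (x n) - N (x (n + 1))‖ := norm_sub_le_norm_sub_add_norm_sub ..
      _ ≤ ‖x (n + 1) - N (x n)‖ + ‖x n - x (n + 1)‖ := by gcongr; exact hN _ _
      _ = ‖x n - N (x n)‖ := by
        rw [h1, h2, norm_smul, norm_smul, Real.norm_of_nonneg (hlam n).1,
          Real.norm_of_nonneg (sub_nonneg.mpr (hlam n).2)]
        ring
  have hbdd : BddBelow (Set.range fun n => ‖x n - N (x n)‖) :=
    ⟨0, by rintro _ ⟨n, rfl⟩; exact norm_nonneg _⟩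
  have hlim := tendsto_atTop_ciInf hanti hbdd
  have hle := fun n => ciInf_le hbdd n
  set L := ⨅ n, ‖x n - N (x n)‖
  have hL0 : 0 ≤ L := le_ciInf fun n => norm_nonneg _
  rcases hL0.eq_or_lt with hL | hL
  · rwa [← hL] at hlim
  refine absurd ?_ hlamsum
  have hnn : ∀ n, 0 ≤ lam n * (1 - lam n) := fun n =>
    mul_nonneg (hlam n).1 (sub_nonneg.mpr (hlam n).2)
  refine summable_of_sum_range_le (c := ‖x 0 - z‖ ^ 2 / L ^ 2) hnn fun n => ?_
  rw [le_div_iff₀ (by positivity)]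
  have key : ‖x n - z‖ ^ 2 + (∑ k ∈ Finset.range n, lam k * (1 - lam k)) * L ^ 2
      ≤ ‖x 0 - z‖ ^ 2 := by
    induction n with
    | zero => simp
    | succ n ih =>
      rw [Finset.sum_range_succ]
      have h1 := krasnoselskiiMann_norm_sub_sq_le hN hlam hx hz n
      have h2 : lam n * (1 - lam n) * L ^ 2 ≤ lam n * (1 - lam n) * ‖x n - N (x n)‖ ^ 2 := by
        gcongr
        · exact hnn n
        · exact hle n
      linarith
  linarith [sq_nonneg ‖x n - z‖]

/-- The demiclosedness principle along an ultrafilter. -/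
theorem apply_eq_self_of_weak_limit (hN : ∀ a b, ‖N a - N b‖ ≤ ‖a - b‖) {U : Ultrafilter ℕ}
    {w : E} {C : ℝ} (hC : ∀ n, ‖x n - w‖ ≤ C)
    (hreg : Tendsto (fun n => ‖x n - N (x n)‖) U (nhds 0))
    (hw : ∀ z, Tendsto (fun n => ⟪x n, z⟫) U (nhds ⟪w, z⟫)) : N w = w := by
  have hle : ∀ n, ‖w - N w‖ ^ 2 + 2 * (⟪x n, w - N w⟫ - ⟪w, w - N w⟫) ≤
      ‖x n - N (x n)‖ ^ 2 + 2 * C * ‖x n - N (x n)‖ := by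
    intro n
    have h1 : ‖x n - N w‖ ≤ ‖x n - N (x n)‖ + ‖x n - w‖ :=
      (norm_sub_le_norm_sub_add_norm_sub _ (N (x n)) _).trans (by gcongr; exact hN _ _)
    have h2 : ‖x n - N w‖ ^ 2 =
        ‖x n - w‖ ^ 2 + 2 * (⟪x n, w - N w⟫ - ⟪w, w - N w⟫) + ‖w - N w‖ ^ 2 := by
      rw [← sub_add_sub_cancel (x n) w (N w), norm_add_sq_real, inner_sub_left]
    have h3 : ‖x n - N w‖ ^ 2 ≤ (‖x n - N (x n)‖ + ‖x n - w‖) ^ 2 := by gcongr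
    have h4 := mul_le_mul_of_nonneg_left (hC n) (norm_nonneg (x n - N (x n)))
    nlinarith
  have hlim1 := (((hw (w - N w)).sub_const ⟪w, w - N w⟫).const_mul 2).const_add (‖w - N w‖ ^ 2)
  have hlim2 := (hreg.pow 2).add (hreg.const_mul (2 * C))
  have hfin := le_of_tendsto_of_tendsto' hlim1 hlim2 hle
  have h0 : ‖w - N w‖ ^ 2 = 0 := le_antisymm (by simpa using hfin) (sq_nonneg _)
  exact (sub_eq_zero.mp (norm_eq_zero.mp (pow_eq_zero_iff two_ne_zero |>.mp h0))).symm

/-- Weak convergence of the Krasnoselskii–Mann iteration to a fixed point. -/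
theorem krasnoselskiiMann_weak_tendsto [CompleteSpace E] (hN : ∀ a b, ‖N a - N b‖ ≤ ‖a - b‖)
    (hlam : ∀ n, lam n ∈ Set.Icc (0 : ℝ) 1)
    (hlamsum : ¬ Summable (fun n => lam n * (1 - lam n)))
    (hx : ∀ n, x (n + 1) = (1 - lam n) • x n + lam n • N (x n))
    {z₀ : E} (hz₀ : N z₀ = z₀) :
    ∃ w, N w = w ∧ ∀ z, Tendsto (fun n => ⟪x n, z⟫) atTop (nhds ⟪w, z⟫) := by
  have hanti := fun z (hz : N z = z) => krasnoselskiiMann_antitone_norm_sub hN hlam hx hz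
  have hreg := krasnoselskiiMann_tendsto_norm_sub_apply hN hlam hlamsum hx hz₀
  have hbdd : ∀ w n, ‖x n - w‖ ≤ ‖x 0 - z₀‖ + ‖z₀ - w‖ := fun w n =>
    (norm_sub_le_norm_sub_add_norm_sub _ z₀ _).trans (by gcongr; exact hanti z₀ hz₀ n.zero_le)
  have hcluster : ∀ U : Ultrafilter ℕ, ↑U ≤ (atTop : Filter ℕ) →
      ∃ w, N w = w ∧ ∀ z, Tendsto (fun n => ⟪x n, z⟫) U (nhds ⟪w, z⟫) := by
    intro U hU
    obtain ⟨w, hw⟩ := exists_weak_limit_ultrafilter U x _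
      fun n => by simpa only [sub_zero] using hbdd 0 n
    exact ⟨w, apply_eq_self_of_weak_limit hN (hbdd w) (hreg.mono_left hU) hw, hw⟩
  have hnorm : ∀ z, N z = z → ∃ a, Tendsto (fun n => ‖x n - z‖) atTop (nhds a) := fun z hz =>
    ⟨_, tendsto_atTop_ciInf (hanti z hz) ⟨0, by rintro _ ⟨n, rfl⟩; exact norm_nonneg _⟩⟩
  obtain ⟨w, hNw, hw⟩ := hcluster (hyperfilter ℕ) Nat.hyperfilter_le_atTop
  refine ⟨w, hNw, fun z => (tendsto_iff_ultrafilter _ _ _).mpr fun U hU => ?_⟩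
  obtain ⟨w', hNw', hw'⟩ := hcluster U hU
  suffices w' = w by rw [← this]; exact hw' z
  obtain ⟨a, ha⟩ := hnorm w hNw
  obtain ⟨b, hb⟩ := hnorm w' hNw'
  have hinner : ∀ n, ⟪x n, w' - w⟫ =
      (‖x n - w‖ ^ 2 - ‖x n - w'‖ ^ 2 + ‖w'‖ ^ 2 - ‖w‖ ^ 2) / 2 := by
    intro n
    rw [norm_sub_sq_real, norm_sub_sq_real, inner_sub_right]
    ring
  have hlim : Tendsto (fun n => ⟪x n, w' - w⟫) atTop
      (nhds ((a ^ 2 - b ^ 2 + ‖w'‖ ^ 2 - ‖w‖ ^ 2) / 2)) := by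
    simp_rw [hinner]
    exact (((((ha.pow 2).sub (hb.pow 2)).add_const _).sub_const _).div_const _)
  have h1 := tendsto_nhds_unique (hw (w' - w)) (hlim.mono_left Nat.hyperfilter_le_atTop)
  have h2 := tendsto_nhds_unique (hw' (w' - w)) (hlim.mono_left hU)
  have h3 : ⟪w' - w, w' - w⟫ = 0 := by rw [inner_sub_left, h1, h2, sub_self]
  exact sub_eq_zero.mp (inner_self_eq_zero.mp h3)

end KrasnoselskiiMann

section ProductSpace

variable {H : Type*} [NormedAddCommGroup H] [InnerProductSpace ℝ H]

theorem MonotoneOp.inner_nonneg_of_mem_smul {A : H → Set H} (hA : MonotoneOp A) {γ : ℝ}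
    (hγ : 0 < γ) {q y z u v : H} (hu : u ∈ γ • A (y + q)) (hv : v ∈ γ • A (z + q)) :
    0 ≤ ⟪y - z, u - v⟫ := by
  obtain ⟨u, hu, rfl⟩ := hu
  obtain ⟨v, hv, rfl⟩ := hv
  have h := hA _ _ _ _ hu hv
  rw [add_sub_add_right_eq_sub] at h
  simp only [← smul_sub, inner_smul_right]
  positivity

/-- The resolvent value is determined by its defining inclusion. -/
theorem MonotoneOp.eq_of_sub_mem_smul {A : H → Set H} (hA : MonotoneOp A) {γ : ℝ}
    (hγ : 0 < γ) {q s y z : H} (hy : s - y ∈ γ • A (y + q)) (hz : s - z ∈ γ • A (z + q)) :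
    y = z := by
  have h := hA.inner_nonneg_of_mem_smul hγ hy hz
  rw [sub_sub_sub_cancel_left, ← neg_sub y z, inner_neg_right, real_inner_self_eq_norm_sq] at h
  have h0 : ‖y - z‖ ^ 2 = 0 := le_antisymm (by linarith) (sq_nonneg _)
  exact sub_eq_zero.mp (norm_eq_zero.mp (pow_eq_zero_iff two_ne_zero |>.mp h0))

theorem norm_smul_sub_sub_sq_le {J : H → H} {β : ℝ} (hβ : 0 < β)
    (hJ : ∀ s t, ‖J s - J t‖ ^ 2 ≤ ⟪J s - J t, s - t⟫) (s t : H) :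
    ‖((2 * β) • J s - s) - ((2 * β) • J t - t)‖ ^ 2 +
      4 * β * (1 - β) * ‖J s - J t‖ ^ 2 ≤ ‖s - t‖ ^ 2 := by
  have h : ((2 * β) • J s - s) - ((2 * β) • J t - t) = (2 * β) • (J s - J t) - (s - t) := by
    module
  rw [h, norm_sub_sq_real, norm_smul, inner_smul_left, mul_pow, Real.norm_eq_abs, sq_abs,
    conj_trivial]
  nlinarith [hJ s t]

variable {r : ℕ}

/-- The reflection `2 P_D - Id` across the diagonal of the product space `Hʳ`. -/
noncomputable def diagReflection (X : PiLp 2 fun _ : Fin r => H) : PiLp 2 fun _ : Fin r => H :=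
  WithLp.toLp 2 fun i => (2 : ℝ) • ((r : ℝ)⁻¹ • ∑ j, X j) - X i

theorem diagReflection_apply (X : PiLp 2 fun _ : Fin r => H) (i : Fin r) :
    diagReflection X i = (2 : ℝ) • ((r : ℝ)⁻¹ • ∑ j, X j) - X i := rfl

theorem diagReflection_sub (X Y : PiLp 2 fun _ : Fin r => H) :
    diagReflection (X - Y) = diagReflection X - diagReflection Y := by
  ext i
  simp only [diagReflection_apply, PiLp.sub_apply, Finset.sum_sub_distrib]
  module

theorem norm_diagReflection_sq (hr : 1 ≤ r) (X : PiLp 2 fun _ : Fin r => H) :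
    ‖diagReflection X‖ ^ 2 = ‖X‖ ^ 2 := by
  have hr0 : (r : ℝ) ≠ 0 := by positivity
  rw [PiLp.norm_sq_eq_of_L2, PiLp.norm_sq_eq_of_L2]
  set m := (r : ℝ)⁻¹ • ∑ j, X j with hm
  have hsum : ∑ i, X i = (r : ℝ) • m := by rw [hm, smul_inv_smul₀ hr0]
  have hterm : ∀ i, ‖diagReflection X i‖ ^ 2 = 4 * ‖m‖ ^ 2 - 4 * ⟪m, X i⟫ + ‖X i‖ ^ 2 := by
    intro i
    rw [diagReflection_apply, ← hm, norm_sub_sq_real, norm_smul, inner_smul_left, conj_trivial,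
      mul_pow, Real.norm_eq_abs, sq_abs]
    ring
  simp_rw [hterm]
  rw [Finset.sum_add_distrib, Finset.sum_sub_distrib, Finset.sum_const, Finset.card_univ,
    Fintype.card_fin, nsmul_eq_mul, ← Finset.mul_sum, ← inner_sum, hsum, inner_smul_right,
    real_inner_self_eq_norm_sq]
  ring

/-- The operator on `Hʳ` whose relaxed iteration is the algorithm. -/
noncomputable def reflectedResolvent (β : ℝ) (J : Fin r → H → H)
    (X : PiLp 2 fun _ : Fin r => H) : PiLp 2 fun _ : Fin r => H :=
  WithLp.toLp 2 fun i => (2 * β) • J i (diagReflection X i) - diagReflection X i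

theorem reflectedResolvent_apply (β : ℝ) (J : Fin r → H → H)
    (X : PiLp 2 fun _ : Fin r => H) (i : Fin r) :
    reflectedResolvent β J X i =
      (2 * β) • J i (diagReflection X i) - diagReflection X i := rfl

theorem sub_reflectedResolvent_apply (β : ℝ) (J : Fin r → H → H)
    (X : PiLp 2 fun _ : Fin r => H) (i : Fin r) :
    X i - reflectedResolvent β J X i =
      (2 : ℝ) • ((r : ℝ)⁻¹ • ∑ j, X j - β • J i (diagReflection X i)) := by
  rw [reflectedResolvent_apply]
  nth_rw 2 [diagReflection_apply]
  module

theorem reflectedResolvent_eq_self_iff {β : ℝ} {J : Fin r → H → H}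
    {X : PiLp 2 fun _ : Fin r => H} :
    reflectedResolvent β J X = X ↔
      ∀ i, β • J i (diagReflection X i) = (r : ℝ)⁻¹ • ∑ j, X j := by
  rw [PiLp.ext_iff]
  refine forall_congr' fun i => ?_
  rw [eq_comm, ← sub_eq_zero, sub_reflectedResolvent_apply, smul_eq_zero_iff_right two_ne_zero,
    sub_eq_zero, eq_comm]

theorem norm_reflectedResolvent_sub_sq_le (hr : 1 ≤ r) {β : ℝ} (hβ : 0 < β) {J : Fin r → H → H}
    (hJ : ∀ i s t, ‖J i s - J i t‖ ^ 2 ≤ ⟪J i s - J i t, s - t⟫)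
    (X Y : PiLp 2 fun _ : Fin r => H) :
    ‖reflectedResolvent β J X - reflectedResolvent β J Y‖ ^ 2 +
      4 * β * (1 - β) * ∑ i, ‖J i (diagReflection X i) - J i (diagReflection Y i)‖ ^ 2 ≤
      ‖X - Y‖ ^ 2 := by
  rw [← norm_diagReflection_sq hr (X - Y), diagReflection_sub, PiLp.norm_sq_eq_of_L2,
    PiLp.norm_sq_eq_of_L2, Finset.mul_sum, ← Finset.sum_add_distrib]
  exact Finset.sum_le_sum fun i _ => norm_smul_sub_sub_sq_le hβ (hJ i) _ _

end ProductSpace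

theorem stmt19 {H : Type*} [NormedAddCommGroup H] [InnerProductSpace ℝ H] [CompleteSpace H]
    (r : ℕ) (hr : 1 ≤ r)
    (A : Fin r → H → Set H) (hA : ∀ i, MaxMonotoneOp (A i))
    (γ β : ℝ) (hγ : 0 < γ) (hβ : β ∈ Set.Ioo (0 : ℝ) 1)
    (lam : ℕ → ℝ) (hlam : ∀ n, lam n ∈ Set.Icc (0 : ℝ) 1)
    (hlamsum : ¬ Summable (fun n => lam n * (1 - lam n)))
    (q : H)
    (hq : q ∈ ranIdAdd (fun x : H => (γ / ((r : ℝ) * (1 - β))) • ∑ i, A i x))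
    -- `J i = J_{γ(Aᵢ)₋q}`: the (single-valued) resolvent of the inner
    -- (−q)-perturbation of `γAᵢ`.
    (J : Fin r → H → H)
    (hJ : ∀ i, ∀ s : H, s - J i s ∈ γ • A i (J i s + q))
    (x : Fin r → ℕ → H) (p : ℕ → H)
    (hp : ∀ n, p n = ((r : ℝ)⁻¹) • ∑ i, x i n)
    (hx : ∀ i n, x i (n + 1) = (1 - lam n) • x i n +
        lam n • ((2 * β) • J i ((2 : ℝ) • p n - x i n) - ((2 : ℝ) • p n - x i n))) :
    ∃ (xs : Fin r → H) (P : H),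
      -- each `(x i n)` converges weakly to `xs i`
      (∀ i, ∀ z : H, Tendsto (fun n => ⟪x i n, z⟫) atTop (nhds ⟪xs i, z⟫)) ∧
      -- `P = J_{(γ/(r(1−β)))∑ᵢAᵢ}(q)`
      q - P ∈ (γ / ((r : ℝ) * (1 - β))) • ∑ i, A i P ∧
      q + (1 / (β * (r : ℝ))) • ∑ i, xs i = P ∧
      -- `(q + (1/β) p n)` converges strongly to `P`
      Tendsto (fun n => q + β⁻¹ • p n) atTop (nhds P) := by
  obtain ⟨hβ0, hβ1⟩ := hβ
  have hr0 : (r : ℝ) ≠ 0 := by positivity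
  have hβ1' : 1 - β ≠ 0 := (sub_pos.mpr hβ1).ne'
  have hJfirm : ∀ i s t, ‖J i s - J i t‖ ^ 2 ≤ ⟪J i s - J i t, s - t⟫ := by
    intro i s t
    have h := (hA i).1.inner_nonneg_of_mem_smul hγ (hJ i s) (hJ i t)
    rw [sub_sub_sub_comm, inner_sub_right, real_inner_self_eq_norm_sq] at h
    linarith
  set N := reflectedResolvent β J with hNdef
  have hNsq := norm_reflectedResolvent_sub_sq_le hr hβ0 hJfirm
  have hN : ∀ X Y, ‖N X - N Y‖ ≤ ‖X - Y‖ := by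
    intro X Y
    have h0 : 0 ≤ 4 * β * (1 - β) *
        ∑ i, ‖J i (diagReflection X i) - J i (diagReflection Y i)‖ ^ 2 :=
      mul_nonneg (mul_nonneg (by positivity) (sub_pos.mpr hβ1).le) (by positivity)
    exact le_of_sq_le_sq (by linarith [hNsq X Y]) (norm_nonneg _)
  let X : ℕ → PiLp 2 fun _ : Fin r => H := fun n => WithLp.toLp 2 fun i => x i n
  have hX : ∀ n, X (n + 1) = (1 - lam n) • X n + lam n • N (X n) := by
    intro n
    ext i
    simp only [X, hNdef, PiLp.add_apply, PiLp.smul_apply, reflectedResolvent_apply,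
      diagReflection_apply, hx, hp]
  obtain ⟨Z, hZ⟩ : ∃ Z, N Z = Z := by
    obtain ⟨P, u, hu, hqP⟩ := hq
    obtain ⟨_, ha, rfl⟩ := hu
    obtain ⟨a, haA, rfl⟩ := (Set.mem_fintype_sum _ _).mp ha
    let Z : PiLp 2 fun _ : Fin r => H :=
      WithLp.toLp 2 fun i => (2 * β) • (P - q) - ((P - q) + γ • a i)
    have hsum : γ • ∑ i, a i = (r : ℝ) • (1 - β) • (q - P) := by
      rw [hqP, add_sub_cancel_left, smul_smul, smul_smul]
      congr 1
      field_simp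
    have hmean : (r : ℝ)⁻¹ • ∑ i, Z i = β • (P - q) := by
      have : ∑ i, Z i = (r : ℝ) • (β • (P - q)) := by
        simp only [Z, Finset.sum_sub_distrib, Finset.sum_add_distrib, ← Finset.smul_sum, hsum,
          Finset.sum_const, Finset.card_univ, Fintype.card_fin, ← Nat.cast_smul_eq_nsmul ℝ]
        module
      rw [this, inv_smul_smul₀ hr0]
    refine ⟨Z, reflectedResolvent_eq_self_iff.mpr fun i => ?_⟩
    rw [hmean]
    congr 1
    have hrefl : diagReflection Z i = (P - q) + γ • a i := by
      rw [diagReflection_apply, hmean]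
      simp only [Z]
      module
    refine (hA i).1.eq_of_sub_mem_smul hγ (hJ i _) ?_
    rw [hrefl, add_sub_cancel_left, sub_add_cancel]
    exact Set.smul_mem_smul_set (haA i)
  obtain ⟨W, hW, hweak⟩ := krasnoselskiiMann_weak_tendsto hN hlam hlamsum hX hZ
  have hWfix := reflectedResolvent_eq_self_iff.mp hW
  set m := (r : ℝ)⁻¹ • ∑ j, W j with hm
  have hJW : ∀ i, J i (diagReflection W i) = β⁻¹ • m := fun i => by
    rw [← hWfix i, inv_smul_smul₀ hβ0.ne']
  refine ⟨fun i => W i, q + β⁻¹ • m, fun i z => ?_, ?_, ?_, ?_⟩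
  · have h := hweak (WithLp.toLp 2 (Pi.single i z))
    have hsingle : ∀ Y : PiLp 2 fun _ : Fin r => H,
        ⟪Y, WithLp.toLp 2 (Pi.single i z)⟫ = ⟪Y i, z⟫ := by
      intro Y
      rw [PiLp.inner_apply, Finset.sum_eq_single i]
      · simp
      · intro j _ hj
        simp [Pi.single_eq_of_ne hj]
      · simp
    simpa only [hsingle] using h
  · have hmem : ∀ i, ∃ a ∈ A i (q + β⁻¹ • m), γ • a = diagReflection W i - β⁻¹ • m := by
      intro i
      have h := hJ i (diagReflection W i)
      rwa [hJW, add_comm _ q] at h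
    choose a haA ha using hmem
    refine ⟨∑ i, a i, Set.finsetSum_mem_finsetSum _ _ _ fun i _ => haA i, ?_⟩
    have hWsum : ∑ i, W i = (r : ℝ) • m := by rw [hm, smul_inv_smul₀ hr0]
    have hrefl : ∀ i, diagReflection W i = (2 : ℝ) • m - W i := fun i => rfl
    have hsum : γ • ∑ i, a i = (r : ℝ) • (1 - β⁻¹) • m := by
      simp only [Finset.smul_sum, ha, hrefl, Finset.sum_sub_distrib, hWsum,
        Finset.sum_const, Finset.card_univ, Fintype.card_fin, ← Nat.cast_smul_eq_nsmul ℝ]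
      module
    change (γ / ((r : ℝ) * (1 - β))) • ∑ i, a i = q - (q + β⁻¹ • m)
    rw [sub_add_cancel_left, div_eq_inv_mul, mul_smul, hsum, smul_smul, smul_smul, ← neg_smul]
    congr 1
    field_simp
    ring
  · rw [hm, smul_smul]
    congr 2
    field_simp
  · refine (Tendsto.const_smul ?_ β⁻¹).const_add q
    have i₀ : Fin r := ⟨0, hr⟩
    have hreg := krasnoselskiiMann_tendsto_norm_sub_apply hN hlam hlamsum hX hW
    have hJle : ∀ n, 4 * β * (1 - β) * ‖J i₀ (diagReflection (X n) i₀) - β⁻¹ • m‖ ^ 2 ≤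
        2 * ‖X 0 - W‖ * ‖X n - N (X n)‖ := by
      intro n
      have h1 := hNsq (X n) W
      have h2 : ‖J i₀ (diagReflection (X n) i₀) - β⁻¹ • m‖ ^ 2 ≤
          ∑ i, ‖J i (diagReflection (X n) i) - J i (diagReflection W i)‖ ^ 2 := by
        rw [← hJW i₀]
        exact Finset.single_le_sum
          (f := fun i => ‖J i (diagReflection (X n) i) - J i (diagReflection W i)‖ ^ 2)
          (fun i _ => sq_nonneg _) (Finset.mem_univ i₀)
      have h3 := mul_le_mul_of_nonneg_left h2
        (mul_nonneg (by positivity) (sub_pos.mpr hβ1).le : 0 ≤ 4 * β * (1 - β))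
      have h4 : ‖X n - W‖ ≤ ‖X 0 - W‖ :=
        krasnoselskiiMann_antitone_norm_sub hN hlam hX hW n.zero_le
      have h5 : ‖X n - W‖ ≤ ‖X n - N (X n)‖ + ‖N (X n) - W‖ :=
        norm_sub_le_norm_sub_add_norm_sub ..
      have h6 : ‖N (X n) - W‖ ≤ ‖X n - W‖ := by simpa only [hW] using hN (X n) W
      rw [← hNdef, hW] at h1
      nlinarith [norm_nonneg (X n - N (X n)), norm_nonneg (X n - W), norm_nonneg (N (X n) - W)]
    have hJsq : Tendsto (fun n => ‖J i₀ (diagReflection (X n) i₀) - β⁻¹ • m‖ ^ 2) atTop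
        (nhds 0) := by
      have hc : 0 < 4 * β * (1 - β) := mul_pos (by positivity) (sub_pos.mpr hβ1)
      refine squeeze_zero (fun n => sq_nonneg _) (fun n => (le_div_iff₀' hc).mpr (hJle n)) ?_
      simpa using (hreg.const_mul (2 * ‖X 0 - W‖)).div_const (4 * β * (1 - β))
    have hJlim : Tendsto (fun n => J i₀ (diagReflection (X n) i₀)) atTop (nhds (β⁻¹ • m)) := by
      rw [tendsto_iff_norm_sub_tendsto_zero]
      simpa [Real.sqrt_sq (norm_nonneg _)] using hJsq.sqrt
    have hregi : Tendsto (fun n => X n i₀ - N (X n) i₀) atTop (nhds 0) :=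
      squeeze_zero_norm (fun n => PiLp.norm_apply_le (X n - N (X n)) i₀) hreg
    have hpn : ∀ n, p n = (2 : ℝ)⁻¹ • (X n i₀ - N (X n) i₀) +
        β • J i₀ (diagReflection (X n) i₀) := by
      intro n
      rw [hNdef, sub_reflectedResolvent_apply, inv_smul_smul₀ two_ne_zero, sub_add_cancel, hp]
    rw [funext hpn]
    simpa [smul_inv_smul₀ hβ0.ne'] using
      (hregi.const_smul (2 : ℝ)⁻¹).add (hJlim.const_smul β)
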